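/- arXiv:2201.04770 — 8 statements merged into one kernel-verified Lean document; each statement's English description precedes it below -/
import Mathlib

section
/- Let D be a labeled ordered instance with a key function, let k ≥ 1, and let t, t' ∈ D with key(t) = key(t') and t < t'. Let I be a primary-key repair of D with t ∈ I and |I| ≥ k, and let I' = (I \ {t}) ∪ {t'} (which is again a primary-key repair of D). Then for every label ℓ ∈ Y it holds that C(ℓ, I') − C(L(t), I') ≥ C(ℓ, I) − C(L(t), I). -/
variable {T K Y : Type*}

/-- The k-neighborhood: the set of the `k` smallest elements of `I` under `<`. -/
def nbhd [LinearOrder T] (k : ℕ) (I : Finset T) : Finset T :=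
  I.filter fun t => (I.filter fun s => s < t).card < k

/-- `labCount L k ℓ I = C(ℓ, I)`: the number of elements of the `k`-neighborhood
of `I` carrying label `ℓ`. -/
def labCount [LinearOrder T] [DecidableEq Y] (L : T → Y) (k : ℕ) (ℓ : Y) (I : Finset T) : ℕ :=
  ((nbhd k I).filter fun t => L t = ℓ).card

/-- A primary-key repair of `D`: a subset of `D` containing exactly one tuple
from each nonempty block (tuples sharing a key). -/
def IsPKRepair [DecidableEq K] (key : T → K) (D I : Finset T) : Prop :=
  I ⊆ D ∧ ∀ t ∈ D, (I.filter fun s => key s = key t).card = 1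

/-- How the rank of `s` changes when `t` is replaced by `t'`. -/
theorem card_filter_lt_insert_erase [LinearOrder T] {I : Finset T} {t t' : T} (htI : t ∈ I)
    (ht'I : t' ∉ I) (s : T) :
    ((insert t' (I.erase t)).filter fun u => u < s).card + (if t < s then 1 else 0) =
      (I.filter fun u => u < s).card + (if t' < s then 1 else 0) := by
  have h_insert : ((insert t' (I.erase t)).filter fun u => u < s).card =
      ((I.erase t).filter fun u => u < s).card + (if t' < s then 1 else 0) := by
    rw [Finset.filter_insert]
    split_ifs
    · exact Finset.card_insert_of_notMem (by simp [ht'I])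
    · rfl
  have h_erase : (I.filter fun u => u < s).card =
      ((I.erase t).filter fun u => u < s).card + (if t < s then 1 else 0) := by
    conv_lhs => rw [← Finset.insert_erase htI, Finset.filter_insert]
    split_ifs
    · exact Finset.card_insert_of_notMem (by simp)
    · rfl
  omega

theorem card_filter_lt_mono [LinearOrder T] (I : Finset T) {a b : T} (hab : a ≤ b) :
    (I.filter fun u => u < a).card ≤ (I.filter fun u => u < b).card :=
  Finset.card_le_card fun _ hu => by
    simp only [Finset.mem_filter] at hu ⊢
    exact ⟨hu.1, hu.2.trans_le hab⟩

theorem card_filter_lt_strictMono [LinearOrder T] {I : Finset T} {a b : T} (ha : a ∈ I)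
    (hab : a < b) : (I.filter fun u => u < a).card < (I.filter fun u => u < b).card := by
  refine Finset.card_lt_card ⟨fun u hu => ?_, fun h => ?_⟩
  · simp only [Finset.mem_filter] at hu ⊢
    exact ⟨hu.1, hu.2.trans hab⟩
  · have := h (Finset.mem_filter.2 ⟨ha, hab⟩)
    simp at this

theorem mem_nbhd [LinearOrder T] {k : ℕ} {I : Finset T} {s : T} :
    s ∈ nbhd k I ↔ s ∈ I ∧ (I.filter fun u => u < s).card < k := by
  simp [nbhd]

/-- Replacing `t` by a larger element pushes no other element out of the neighborhood. -/
theorem nbhd_erase_subset_nbhd [LinearOrder T] {k : ℕ} {I : Finset T} {t t' : T} (htI : t ∈ I)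
    (ht'I : t' ∉ I) (htt' : t < t') :
    (nbhd k I).erase t ⊆ nbhd k (insert t' (I.erase t)) := by
  intro s hs
  rw [Finset.mem_erase, mem_nbhd] at hs
  have h_rank := card_filter_lt_insert_erase htI ht'I s
  refine mem_nbhd.2 ⟨by simp [hs.1, hs.2.1], ?_⟩
  grind

/-- Replacing `t` by a larger element lets at most one new element into the neighborhood. -/
theorem card_nbhd_sdiff_erase_le_one [LinearOrder T] {k : ℕ} {I : Finset T} {t t' : T}
    (htI : t ∈ I) (ht'I : t' ∉ I) (htt' : t < t') :
    (nbhd k (insert t' (I.erase t)) \ (nbhd k I).erase t).card ≤ 1 := by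
  have h_not_lt : ∀ a ∈ nbhd k (insert t' (I.erase t)) \ (nbhd k I).erase t,
      ∀ b ∈ nbhd k (insert t' (I.erase t)) \ (nbhd k I).erase t, ¬ a < b := by
    intro a ha b hb hab
    simp only [Finset.mem_sdiff, Finset.mem_erase, mem_nbhd, Finset.mem_insert] at ha hb
    have h_rank_a := card_filter_lt_insert_erase htI ht'I a
    have h_rank_b := card_filter_lt_insert_erase htI ht'I b
    have h_lt := card_filter_lt_strictMono (I := insert t' (I.erase t)) (a := a) (b := b)
      (by simpa using ha.1.1) hab
    grind
  refine Finset.card_le_one.2 fun a ha b hb => ?_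
  exact le_antisymm (not_lt.1 (h_not_lt b hb a ha)) (not_lt.1 (h_not_lt a ha b hb))

/-- Replacing an element outside the neighborhood by a larger one adds nothing to it. -/
theorem nbhd_insert_erase_subset [LinearOrder T] {k : ℕ} {I : Finset T} {t t' : T}
    (htI : t ∈ I) (ht'I : t' ∉ I) (htt' : t < t') (ht : t ∉ nbhd k I) :
    nbhd k (insert t' (I.erase t)) ⊆ nbhd k I := by
  intro s hs
  rw [mem_nbhd] at hs ht ⊢
  have h_rank_t := card_filter_lt_insert_erase htI ht'I t
  have h_rank_s := card_filter_lt_insert_erase htI ht'I s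
  have hst : s < t := by
    by_contra! h
    have := card_filter_lt_mono (insert t' (I.erase t)) h
    grind
  grind

theorem labCount_le_labCount_insert_erase [LinearOrder T] [DecidableEq Y] (L : T → Y) {k : ℕ}
    {I : Finset T} {t t' : T} (htI : t ∈ I) (ht'I : t' ∉ I) (htt' : t < t') {ℓ : Y}
    (hℓ : ℓ ≠ L t) : labCount L k ℓ I ≤ labCount L k ℓ (insert t' (I.erase t)) := by
  refine Finset.card_le_card fun s hs => ?_
  rw [Finset.mem_filter] at hs ⊢
  refine ⟨nbhd_erase_subset_nbhd htI ht'I htt' (Finset.mem_erase.2 ⟨?_, hs.1⟩), hs.2⟩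
  rintro rfl
  exact hℓ hs.2.symm

theorem labCount_insert_erase_le_labCount [LinearOrder T] [DecidableEq Y] (L : T → Y) {k : ℕ}
    {I : Finset T} {t t' : T} (htI : t ∈ I) (ht'I : t' ∉ I) (htt' : t < t') :
    labCount L k (L t) (insert t' (I.erase t)) ≤ labCount L k (L t) I := by
  unfold labCount
  by_cases ht : t ∈ nbhd k I
  · set N := nbhd k I
    set N' := nbhd k (insert t' (I.erase t))
    calc (N'.filter fun s => L s = L t).card
        ≤ (((N.filter fun s => L s = L t).erase t) ∪ (N' \ N.erase t)).card :=
          Finset.card_le_card fun s hs => by grind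
      _ ≤ ((N.filter fun s => L s = L t).erase t).card + (N' \ N.erase t).card :=
          Finset.card_union_le _ _
      _ ≤ ((N.filter fun s => L s = L t).erase t).card + 1 :=
          Nat.add_le_add_left (card_nbhd_sdiff_erase_le_one htI ht'I htt') _
      _ = (N.filter fun s => L s = L t).card :=
          Finset.card_erase_add_one (by simp [ht])
  · exact Finset.card_le_card
      (Finset.filter_subset_filter _ (nbhd_insert_erase_subset htI ht'I htt' ht))

theorem IsPKRepair.notMem_of_key_eq [DecidableEq K] {key : T → K} {D I : Finset T}
    (hI : IsPKRepair key D I) {t t' : T} (ht : t ∈ D) (htI : t ∈ I) (hkey : key t = key t')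
    (hne : t ≠ t') : t' ∉ I := fun ht'I =>
  hne (Finset.card_le_one.1 (hI.2 t ht).le t (by simp [htI]) t' (by simp [ht'I, hkey]))

theorem IsPKRepair.insert_erase [DecidableEq T] [DecidableEq K] {key : T → K} {D I : Finset T}
    (hI : IsPKRepair key D I) {t t' : T} (ht' : t' ∈ D) (htI : t ∈ I) (hkey : key t = key t')
    (ht'I : t' ∉ I) : IsPKRepair key D (insert t' (I.erase t)) := by
  refine ⟨Finset.insert_subset ht' ((Finset.erase_subset _ _).trans hI.1), fun u hu => ?_⟩
  have h_card := hI.2 u hu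
  rw [Finset.filter_insert, Finset.filter_erase]
  split_ifs with h
  · have ht_mem : t ∈ I.filter fun s => key s = key u := by simp [htI, hkey, h]
    rw [Finset.card_insert_of_notMem (by simp [ht'I]), Finset.card_erase_add_one ht_mem, h_card]
  · rwa [Finset.erase_eq_of_notMem (by simp [hkey, h])]

theorem stmt0 [LinearOrder T] [DecidableEq K] [DecidableEq Y]
    (D : Finset T) (key : T → K) (L : T → Y) (k : ℕ) (hk : 1 ≤ k)
    (t t' : T) (ht : t ∈ D) (ht' : t' ∈ D) (hkey : key t = key t') (htt' : t < t')
    (I : Finset T) (hI : IsPKRepair key D I) (htI : t ∈ I) (hIk : k ≤ I.card)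
    (I' : Finset T) (hI' : I' = insert t' (I.erase t)) :
    IsPKRepair key D I' ∧
      ∀ ℓ : Y, (labCount L k ℓ I : ℤ) - (labCount L k (L t) I : ℤ) ≤
        (labCount L k ℓ I' : ℤ) - (labCount L k (L t) I' : ℤ) := by
  have ht'I : t' ∉ I := hI.notMem_of_key_eq ht htI hkey htt'.ne
  subst hI'
  refine ⟨hI.insert_erase ht' htI hkey ht'I, fun ℓ => ?_⟩
  by_cases hℓ : ℓ = L t
  · simp [hℓ]
  · have h_le := labCount_le_labCount_insert_erase (k := k) L htI ht'I htt' hℓ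
    have h_ge := labCount_insert_erase_le_labCount (k := k) L htI ht'I htt'
    omega
end

section
/- Let D be a labeled ordered instance with a key function, let ℓ1 ≠ ℓ2 be labels in Y, and let D* = Prune(D, ℓ2, ℓ1). Then: (a) every nonempty block of D has nonempty intersection with D*; (b) every block of D* contains at most one tuple whose label lies in {ℓ1, ℓ2}; and (c) every tuple of D* whose label lies in {ℓ1, ℓ2} is the <-maximal element of its block in D*. -/
variable {T K Y : Type*}

/-- `Prune(D, ℓ2, ℓ1)`: remove every tuple `t` for which some tuple `t'` in the
same block satisfies (`t < t'` and `L t = ℓ1`) or (`t' < t` and `L t' = ℓ2`). -/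
def Prune [LinearOrder T] [DecidableEq K] [DecidableEq Y]
    (key : T → K) (L : T → Y) (D : Finset T) (ℓ2 ℓ1 : Y) : Finset T :=
  D.filter fun t => ¬ ∃ t' ∈ D, key t' = key t ∧
    ((t < t' ∧ L t = ℓ1) ∨ (t' < t ∧ L t' = ℓ2))

theorem mem_prune [LinearOrder T] [DecidableEq K] [DecidableEq Y]
    {key : T → K} {L : T → Y} {D : Finset T} {ℓ2 ℓ1 : Y} {t : T} :
    t ∈ Prune key L D ℓ2 ℓ1 ↔ t ∈ D ∧ ∀ t' ∈ D, key t' = key t →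
      (t < t' → L t ≠ ℓ1) ∧ (t' < t → L t' ≠ ℓ2) := by
  simp only [Prune, Finset.mem_filter]
  grind

/-- The first `ℓ2`-tuple of a block survives pruning; without one, the last tuple does. -/
theorem exists_mem_prune_key_eq [LinearOrder T] [DecidableEq K] [DecidableEq Y]
    {key : T → K} {L : T → Y} {D : Finset T} {ℓ1 ℓ2 : Y} (hℓ : ℓ1 ≠ ℓ2) {t : T} (ht : t ∈ D) :
    ∃ s ∈ Prune key L D ℓ2 ℓ1, key s = key t := by
  by_cases h : (D.filter fun s => key s = key t ∧ L s = ℓ2).Nonempty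
  · obtain ⟨s, hs, hmin⟩ := Finset.exists_min_image _ id h
    simp only [Finset.mem_filter, id] at hs hmin
    refine ⟨s, mem_prune.2 ⟨hs.1, fun t' ht' hk => ⟨fun _ => ?_, fun hlt hL => ?_⟩⟩, hs.2.1⟩
    · rw [hs.2.2]
      exact hℓ.symm
    · exact hlt.not_ge (hmin t' ⟨ht', hk.trans hs.2.1, hL⟩)
  · obtain ⟨s, hs, hmax⟩ := Finset.exists_max_image (D.filter fun s => key s = key t) id
      ⟨t, Finset.mem_filter.2 ⟨ht, rfl⟩⟩
    simp only [Finset.mem_filter, id] at hs hmax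
    refine ⟨s, mem_prune.2 ⟨hs.1, fun t' ht' hk => ⟨fun hlt => ?_, fun _ hL => h ?_⟩⟩, hs.2⟩
    · exact absurd (hmax t' ⟨ht', hk.trans hs.2⟩) hlt.not_ge
    · exact ⟨t', Finset.mem_filter.2 ⟨ht', hk.trans hs.2, hL⟩⟩

theorem le_of_mem_prune [LinearOrder T] [DecidableEq K] [DecidableEq Y]
    {key : T → K} {L : T → Y} {D : Finset T} {ℓ1 ℓ2 : Y} {t s : T}
    (ht : t ∈ Prune key L D ℓ2 ℓ1) (hL : L t = ℓ1 ∨ L t = ℓ2)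
    (hs : s ∈ Prune key L D ℓ2 ℓ1) (hk : key s = key t) : s ≤ t := by
  rw [mem_prune] at ht hs
  by_contra! hlt
  rcases hL with h | h
  · exact (ht.2 s hs.1 hk).1 hlt h
  · exact (hs.2 t ht.1 hk.symm).2 hlt h

theorem stmt2 [LinearOrder T] [DecidableEq K] [DecidableEq Y]
    (D : Finset T) (key : T → K) (L : T → Y)
    (ℓ1 ℓ2 : Y) (hℓ : ℓ1 ≠ ℓ2)
    (Dstar : Finset T) (hDstar : Dstar = Prune key L D ℓ2 ℓ1) :
    -- (a) every nonempty block of D meets D*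
    (∀ t ∈ D, ∃ s ∈ Dstar, key s = key t) ∧
    -- (b) every block of D* contains at most one tuple with label in {ℓ1, ℓ2}
    (∀ t ∈ Dstar, ∀ t' ∈ Dstar, key t = key t' →
      (L t = ℓ1 ∨ L t = ℓ2) → (L t' = ℓ1 ∨ L t' = ℓ2) → t = t') ∧
    -- (c) every tuple of D* with label in {ℓ1, ℓ2} is the <-maximal element of its block in D*
    (∀ t ∈ Dstar, (L t = ℓ1 ∨ L t = ℓ2) → ∀ s ∈ Dstar, key s = key t → s ≤ t) := by
  subst hDstar
  exact ⟨fun _ ht => exists_mem_prune_key_eq hℓ ht,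
    fun _ ht _ ht' hk hL hL' =>
      le_antisymm (le_of_mem_prune ht' hL' ht hk) (le_of_mem_prune ht hL ht' hk.symm),
    fun _ ht hL _ hs hk => le_of_mem_prune ht hL hs hk⟩
end

section
/- Let D be a labeled ordered instance with a key function such that D = Prune(D, ℓ2, ℓ1) for labels ℓ1 ≠ ℓ2, let t_1 < t_2 < … < t_n enumerate D, and let k ≥ 1 be at most the number of blocks of D. For 1 ≤ i ≤ n define B_i = {key(t_j) : j ≤ i}, B□_i = the set of keys whose entire block is contained in {t_1,…,t_i}, n2_i = |{j ≤ i : L(t_j) = ℓ2}|, and n1_i = |{j ≤ i : the block of t_j equals {t_j} and L(t_j) = ℓ1}|. Then there exists a primary-key repair I of D with C(ℓ2, I) ≥ C(ℓ1, I) if and only if there exists an index i with |B□_i| ≤ k ≤ |B_i| and n2_i ≥ n1_i. -/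
variable {T K Y : Type*}

/-- The prefix of `D` consisting of tuples up to (and including) `t`:
if `t` is the `i`-th tuple of `D` in increasing order, this is `{t_1, …, t_i}`. -/
def prefixOf [LinearOrder T] (D : Finset T) (t : T) : Finset T :=
  D.filter fun s => s ≤ t

/-- If exactly `k` elements of `I` are at most `t`, they form the `k`-neighborhood. -/
theorem nbhd_eq_filter_le [LinearOrder T] {k : ℕ} {I : Finset T} {t : T}
    (h : (I.filter fun s => s ≤ t).card = k) : nbhd k I = I.filter fun s => s ≤ t := by
  subst h
  refine Finset.filter_congr fun s hs => ⟨fun hlt => ?_, fun hst => ?_⟩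
  · by_contra! hts
    refine absurd hlt (not_lt.2 (Finset.card_le_card fun x hx => ?_))
    simp only [Finset.mem_filter] at hx ⊢
    exact ⟨hx.1, hx.2.trans_lt hts⟩
  · refine Finset.card_lt_card (Finset.ssubset_iff_subset_ne.2 ⟨fun x hx => ?_, fun heq => ?_⟩)
    · simp only [Finset.mem_filter] at hx ⊢
      exact ⟨hx.1, hx.2.le.trans hst⟩
    · have : s ∈ I.filter fun x => x < s := by
        rw [heq]
        exact Finset.mem_filter.2 ⟨hs, hst⟩
      simp at this

theorem exists_card_filter_le_eq [LinearOrder T] {k : ℕ} {I : Finset T}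
    (hk : 1 ≤ k) (hkI : k ≤ I.card) : ∃ t ∈ I, (I.filter fun s => s ≤ t).card = k := by
  let i : Fin I.card := ⟨k - 1, by omega⟩
  let e := I.orderEmbOfFin rfl
  refine ⟨e i, I.orderEmbOfFin_mem rfl i, ?_⟩
  have : (I.filter fun s => s ≤ e i) = (Finset.Iic i).map e.toEmbedding := by
    ext s
    simp only [Finset.mem_filter, Finset.mem_map, Finset.mem_Iic]
    constructor
    · rintro ⟨hs, hle⟩
      have hs' : s ∈ Set.range (I.orderEmbOfFin rfl) := by
        rw [Finset.range_orderEmbOfFin]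
        exact hs
      obtain ⟨j, rfl⟩ := hs'
      exact ⟨j, e.le_iff_le.1 hle, rfl⟩
    · rintro ⟨j, hj, rfl⟩
      exact ⟨I.orderEmbOfFin_mem rfl j, e.le_iff_le.2 hj⟩
  rw [this, Finset.card_map, Fin.card_Iic]
  simp only [i]
  omega

theorem IsPKRepair.exists_mem [DecidableEq K] {key : T → K} {D I : Finset T}
    (h : IsPKRepair key D I) {t : T} (ht : t ∈ D) : ∃ s ∈ I, key s = key t := by
  obtain ⟨s, hs⟩ := Finset.card_eq_one.1 (h.2 t ht)
  exact ⟨s, Finset.mem_filter.1 (hs ▸ Finset.mem_singleton_self s)⟩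

theorem IsPKRepair.injOn [DecidableEq K] {key : T → K} {D I : Finset T}
    (h : IsPKRepair key D I) : Set.InjOn key I := by
  intro s hs s' hs' heq
  exact Finset.card_le_one.1 (h.2 s' (h.1 hs')).le s (Finset.mem_filter.2 ⟨hs, heq⟩) s'
    (Finset.mem_filter.2 ⟨hs', rfl⟩)

theorem IsPKRepair.image_eq [DecidableEq K] {key : T → K} {D I : Finset T}
    (h : IsPKRepair key D I) : I.image key = D.image key := by
  refine (Finset.image_subset_image h.1).antisymm fun a ha => ?_
  obtain ⟨t, ht, rfl⟩ := Finset.mem_image.1 ha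
  obtain ⟨s, hs, hst⟩ := h.exists_mem ht
  exact Finset.mem_image.2 ⟨s, hs, hst⟩

/-- A section of `key` over the keys of `D` yields a primary-key repair. -/
theorem isPKRepair_image [DecidableEq T] [DecidableEq K] {key : T → K} {D : Finset T}
    {f : K → T} (hf : ∀ a ∈ D.image key, f a ∈ D ∧ key (f a) = a) :
    IsPKRepair key D ((D.image key).image f) := by
  refine ⟨fun s hs => ?_, fun t ht => Finset.card_eq_one.2 ⟨f (key t), ?_⟩⟩
  · obtain ⟨a, ha, rfl⟩ := Finset.mem_image.1 hs
    exact (hf a ha).1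
  · ext s
    rw [Finset.mem_filter, Finset.mem_singleton, Finset.mem_image]
    constructor
    · rintro ⟨⟨a, ha, rfl⟩, hkey⟩
      rw [← hkey, (hf a ha).2]
    · rintro rfl
      have hmem := Finset.mem_image_of_mem key ht
      exact ⟨⟨_, hmem, rfl⟩, (hf _ hmem).2⟩

/-- In a pruned instance, a tuple labeled `ℓ1` or `ℓ2` is the last one of its block. -/
theorem le_of_prune_eq [LinearOrder T] [DecidableEq K] [DecidableEq Y]
    {key : T → K} {L : T → Y} {D : Finset T} {ℓ1 ℓ2 : Y} (h : Prune key L D ℓ2 ℓ1 = D)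
    {s s' : T} (hs : s ∈ D) (hs' : s' ∈ D) (hkey : key s' = key s)
    (hL : L s = ℓ1 ∨ L s = ℓ2) : s' ≤ s := by
  by_contra! hlt
  rcases hL with hL | hL
  · rw [← h] at hs
    exact (Finset.mem_filter.1 hs).2 ⟨s', hs', hkey, .inl ⟨hlt, hL⟩⟩
  · rw [← h] at hs'
    exact (Finset.mem_filter.1 hs').2 ⟨s, hs, hkey.symm, .inr ⟨hlt, hL⟩⟩

/-- In a pruned instance, given a set `M` of keys between those of the blocks contained in the
prefix up to `t` and those of the blocks meeting it, each block has a tuple that lies in the prefix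
exactly when its key is in `M`, avoids `ℓ1` in the prefix unless forced, and realizes `ℓ2` in the
prefix whenever the block does. -/
theorem exists_choice_of_prune_eq [LinearOrder T] [DecidableEq K] [DecidableEq Y]
    {key : T → K} {L : T → Y} {D : Finset T} {ℓ1 ℓ2 : Y} (hℓ : ℓ1 ≠ ℓ2)
    (h : Prune key L D ℓ2 ℓ1 = D) {t : T} {M : Finset K}
    (hfull : ((D.image key).filter fun a => ∀ s ∈ D, key s = a → s ≤ t) ⊆ M)
    (hmeet : M ⊆ (prefixOf D t).image key) {a : K} (ha : a ∈ D.image key) :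
    ∃ s, (s ∈ D ∧ key s = a) ∧ (s ≤ t ↔ a ∈ M) ∧
      (s ≤ t → L s = ℓ1 → ∀ s' ∈ D, key s' = a → s' = s) ∧
      ∀ s' ∈ D, key s' = a → s' ≤ t → L s' = ℓ2 → s = s' := by
  by_cases haM : a ∈ M
  · by_cases hex : ∃ s ∈ D, key s = a ∧ s ≤ t ∧ L s = ℓ2
    · obtain ⟨s, hs, hsa, hst, hL⟩ := hex
      exact ⟨s, ⟨hs, hsa⟩, by simp [hst, haM], fun _ hL1 => absurd (hL1.symm.trans hL) hℓ,
        fun s' hs' hsa' _ hL' =>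
          (le_of_prune_eq h hs' hs (hsa.trans hsa'.symm) (.inr hL')).antisymm
            (le_of_prune_eq h hs hs' (hsa'.trans hsa.symm) (.inr hL))⟩
    · obtain ⟨r, hr, hra⟩ := Finset.mem_image.1 (hmeet haM)
      obtain ⟨hrD, hrt⟩ := Finset.mem_filter.1 hr
      obtain ⟨s, hs, hmin⟩ := (D.filter fun s => key s = a).exists_min_image id
        ⟨r, Finset.mem_filter.2 ⟨hrD, hra⟩⟩
      obtain ⟨hsD, hsa⟩ := Finset.mem_filter.1 hs
      have hst : s ≤ t := (hmin r (Finset.mem_filter.2 ⟨hrD, hra⟩)).trans hrt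
      exact ⟨s, ⟨hsD, hsa⟩, by simp [hst, haM], fun _ hL s' hs' hsa' =>
          (le_of_prune_eq h hsD hs' (hsa'.trans hsa.symm) (.inl hL)).antisymm
            (hmin s' (Finset.mem_filter.2 ⟨hs', hsa'⟩)),
        fun s' hs' hsa' hst' hL' => absurd ⟨s', hs', hsa', hst', hL'⟩ hex⟩
  · have hnot : ¬ ∀ s ∈ D, key s = a → s ≤ t := fun hall =>
      haM (hfull (Finset.mem_filter.2 ⟨ha, hall⟩))
    push Not at hnot
    obtain ⟨s, hs, hsa, hts⟩ := hnot
    exact ⟨s, ⟨hs, hsa⟩, by simp [hts, haM], fun hst => absurd hst hts.not_ge,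
      fun s' hs' hsa' hst' hL' => absurd
        ((le_of_prune_eq h hs' hs (hsa.trans hsa'.symm) (.inr hL')).trans hst') hts.not_ge⟩

theorem stmt3 [LinearOrder T] [DecidableEq K] [DecidableEq Y]
    (D : Finset T) (key : T → K) (L : T → Y)
    (ℓ1 ℓ2 : Y) (hℓ : ℓ1 ≠ ℓ2)
    (hpruned : Prune key L D ℓ2 ℓ1 = D)
    (k : ℕ) (hk : 1 ≤ k) (hkblocks : k ≤ (D.image key).card) :
    (∃ I : Finset T, IsPKRepair key D I ∧ labCount L k ℓ1 I ≤ labCount L k ℓ2 I) ↔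
      -- there is a prefix {t_1, …, t_i} of D (determined by its last element t = t_i) with
      -- |B□_i| ≤ k ≤ |B_i| and n2_i ≥ n1_i
      (∃ t ∈ D,
        -- |B□_i| ≤ k : the keys whose entire block lies in the prefix
        ((D.image key).filter fun a => ∀ s ∈ D, key s = a → s ≤ t).card ≤ k ∧
        -- k ≤ |B_i| : the keys occurring in the prefix
        k ≤ ((prefixOf D t).image key).card ∧
        -- n1_i ≤ n2_i
        ((prefixOf D t).filter fun s => L s = ℓ1 ∧
            ∀ s' ∈ D, key s' = key s → s' = s).card ≤
          ((prefixOf D t).filter fun s => L s = ℓ2).card) := by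
  constructor
  · rintro ⟨I, hI, hcount⟩
    have hcard : k ≤ I.card := by
      rw [← Finset.card_image_of_injOn hI.injOn, hI.image_eq]
      exact hkblocks
    obtain ⟨t, ht, htk⟩ := exists_card_filter_le_eq hk hcard
    simp only [labCount, nbhd_eq_filter_le htk, Finset.filter_filter] at hcount
    refine ⟨t, hI.1 ht, ?_, ?_, (Finset.card_le_card ?_).trans
      (hcount.trans (Finset.card_le_card ?_))⟩
    · rw [← htk]
      refine (Finset.card_le_card fun a ha => ?_).trans
        (Finset.card_image_le (f := key))
      obtain ⟨ha, hall⟩ := Finset.mem_filter.1 ha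
      obtain ⟨s, hs, rfl⟩ := Finset.mem_image.1 (hI.image_eq ▸ ha)
      exact Finset.mem_image_of_mem key (Finset.mem_filter.2 ⟨hs, hall s (hI.1 hs) rfl⟩)
    · rw [← htk, ← Finset.card_image_of_injOn
        (hI.injOn.mono (Finset.coe_subset.2 (Finset.filter_subset _ I)))]
      exact Finset.card_le_card (Finset.image_subset_image (Finset.filter_subset_filter _ hI.1))
    · intro s hs
      simp only [prefixOf, Finset.mem_filter] at hs ⊢
      obtain ⟨⟨hsD, hst⟩, hL, hsingle⟩ := hs
      obtain ⟨r, hr, hrs⟩ := hI.exists_mem hsD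
      exact ⟨hsingle r (hI.1 hr) hrs ▸ hr, hst, hL⟩
    · intro s hs
      simp only [prefixOf, Finset.mem_filter] at hs ⊢
      exact ⟨⟨hI.1 hs.1, hs.2.1⟩, hs.2.2⟩
  · rintro ⟨t, -, hfull, hmeet, hcount⟩
    have hsub : ((D.image key).filter fun a => ∀ s ∈ D, key s = a → s ≤ t) ⊆
        (prefixOf D t).image key := by
      intro a ha
      obtain ⟨ha, hall⟩ := Finset.mem_filter.1 ha
      obtain ⟨s, hs, rfl⟩ := Finset.mem_image.1 ha
      exact Finset.mem_image_of_mem key (Finset.mem_filter.2 ⟨hs, hall s hs rfl⟩)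
    obtain ⟨M, hFM, hMB, rfl⟩ := Finset.exists_subsuperset_card_eq hsub hfull hmeet
    have hMD : M ⊆ D.image key :=
      hMB.trans (Finset.image_subset_image (Finset.filter_subset _ D))
    have hchoice : ∀ a, ∃ s, a ∈ D.image key → (s ∈ D ∧ key s = a) ∧ (s ≤ t ↔ a ∈ M) ∧
        (s ≤ t → L s = ℓ1 → ∀ s' ∈ D, key s' = a → s' = s) ∧
        ∀ s' ∈ D, key s' = a → s' ≤ t → L s' = ℓ2 → s = s' := by
      intro a
      by_cases ha : a ∈ D.image key
      · obtain ⟨s, hs⟩ := exists_choice_of_prune_eq hℓ hpruned hFM hMB ha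
        exact ⟨s, fun _ => hs⟩
      · obtain ⟨b, hb⟩ := Finset.card_pos.1 (hk.trans hkblocks)
        obtain ⟨s, -, -⟩ := Finset.mem_image.1 hb
        exact ⟨s, fun h => absurd h ha⟩
    choose f hf using hchoice
    have hprefix : (((D.image key).image f).filter fun s => s ≤ t) = M.image f := by
      ext s
      simp only [Finset.mem_filter]
      constructor
      · rintro ⟨hs, hst⟩
        obtain ⟨a, ha, rfl⟩ := Finset.mem_image.1 hs
        exact Finset.mem_image_of_mem f ((hf a ha).2.1.1 hst)
      · intro hs
        obtain ⟨a, ha, rfl⟩ := Finset.mem_image.1 hs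
        exact ⟨Finset.mem_image_of_mem f (hMD ha), (hf a (hMD ha)).2.1.2 ha⟩
    have hinj : Set.InjOn f M := fun a ha b hb hab => by
      rw [← (hf a (hMD ha)).1.2, hab, (hf b (hMD hb)).1.2]
    have hnbhd := nbhd_eq_filter_le
      ((congrArg Finset.card hprefix).trans (Finset.card_image_of_injOn hinj))
    refine ⟨(D.image key).image f, isPKRepair_image fun a ha => (hf a ha).1, ?_⟩
    simp only [labCount, hnbhd]
    refine (Finset.card_le_card fun s hs => ?_).trans
      (hcount.trans (Finset.card_le_card fun s hs => ?_))
    · obtain ⟨hs, hL⟩ := Finset.mem_filter.1 hs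
      obtain ⟨hs, hst⟩ := Finset.mem_filter.1 hs
      obtain ⟨a, ha, rfl⟩ := Finset.mem_image.1 hs
      obtain ⟨⟨hD, hkey⟩, -, hsingle, -⟩ := hf a ha
      refine Finset.mem_filter.2 ⟨Finset.mem_filter.2 ⟨hD, hst⟩, hL, ?_⟩
      rw [hkey]
      exact hsingle hst hL
    · obtain ⟨hs, hL⟩ := Finset.mem_filter.1 hs
      obtain ⟨hsD, hst⟩ := Finset.mem_filter.1 hs
      have hmem := Finset.mem_image_of_mem key hsD
      have heq := (hf _ hmem).2.2.2 s hsD rfl hst hL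
      exact Finset.mem_filter.2
        ⟨Finset.mem_filter.2 ⟨Finset.mem_image.2 ⟨_, hmem, heq⟩, hst⟩, hL⟩
end

section
/- Let φ be a SAT-3-restricted instance given by occurrence maps κ, λ, μ, and let G(φ) be its associated labeled graph. Then φ is satisfiable if and only if G(φ) has a maximal matching M such that every edge of M has label 1. -/
/-- Vertices of the graph `G(φ)`: `Sum.inl (i, true)` is `C_i^+`,
`Sum.inl (i, false)` is `C_i^-`, `Sum.inr (j, ν, true)` is `x_j^ν`, and
`Sum.inr (j, ν, false)` is `y_j^ν`. -/
abbrev Vtx (m n : ℕ) := (Fin m × Bool) ⊕ (Fin n × Fin 3 × Bool)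

/-- The labeled edges of `G(φ)`, where `true` stands for label 1 and `false`
for label 0. -/
def Edges {m n : ℕ} (κ lam μ : Fin n → Fin m) : Set (Sym2 (Vtx m n) × Bool) :=
  { e | (∃ i : Fin m, e = (s(Sum.inl (i, true), Sum.inl (i, false)), false)) ∨
        (∃ j : Fin n,
          e = (s(Sum.inl (κ j, true), Sum.inr (j, 0, true)), true) ∨
          e = (s(Sum.inr (j, 0, false), Sum.inr (j, 0, true)), true) ∨
          e = (s(Sum.inl (lam j, true), Sum.inr (j, 1, true)), true) ∨
          e = (s(Sum.inr (j, 1, false), Sum.inr (j, 1, true)), true) ∨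
          e = (s(Sum.inr (j, 2, true), Sum.inl (μ j, false)), true) ∨
          e = (s(Sum.inr (j, 2, true), Sum.inr (j, 2, false)), true) ∨
          e = (s(Sum.inr (j, 0, false), Sum.inr (j, 2, false)), false) ∨
          e = (s(Sum.inr (j, 1, false), Sum.inr (j, 2, false)), false)) }

/-- A set of labeled edges is a matching if no two distinct edges share a vertex. -/
def IsMatching {m n : ℕ} (M : Set (Sym2 (Vtx m n) × Bool)) : Prop :=
  ∀ e ∈ M, ∀ e' ∈ M, e ≠ e' → ∀ v : Vtx m n, v ∈ e.1 → v ∉ e'.1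

/-- Adding an edge to a matching breaks it exactly when the edge meets one of its members. -/
theorem not_isMatching_insert_iff {m n : ℕ} {M : Set (Sym2 (Vtx m n) × Bool)}
    (hM : IsMatching M) {e : Sym2 (Vtx m n) × Bool} (he : e ∉ M) :
    ¬ IsMatching (insert e M) ↔ ∃ e' ∈ M, ∃ v, v ∈ e.1 ∧ v ∈ e'.1 := by
  constructor
  · intro h
    by_contra! hdisj
    refine h fun a ha b hb hab v hva hvb => ?_
    rcases ha with rfl | ha <;> rcases hb with rfl | hb
    · exact hab rfl
    · exact hdisj b hb v hva hvb
    · exact hdisj a ha v hvb hva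
    · exact hM a ha b hb hab v hva hvb
  · rintro ⟨e', he', v, hv, hv'⟩ h
    exact h e (Set.mem_insert _ _) e' (Set.mem_insert_of_mem _ he')
      (fun h => he (h ▸ he')) v hv hv'

/-- The clause containing the `ν`-th occurrence of the variable `j`, for `p = (j, ν)`. -/
def occurrenceClause {m n : ℕ} (κ lam μ : Fin n → Fin m) (p : Fin n × Fin 3) : Fin m :=
  ![κ, lam, μ] p.2 p.1

/-- The edge covering `x_j^ν`, for `p = (j, ν)`: it leads to the clause of that occurrence if the
clause has selected the occurrence through `g`, and to `y_j^ν` otherwise. -/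
def selectionEdge {m n : ℕ} (κ lam μ : Fin n → Fin m) (g : Fin m → Fin n × Fin 3)
    (p : Fin n × Fin 3) : Sym2 (Vtx m n) × Bool :=
  (s(Sum.inr (p.1, p.2, true),
    if g (occurrenceClause κ lam μ p) = p then
      Sum.inl (occurrenceClause κ lam μ p, decide (p.2 ≠ 2))
    else Sum.inr (p.1, p.2, false)), true)

theorem range_selectionEdge_subset {m n : ℕ} (κ lam μ : Fin n → Fin m)
    (g : Fin m → Fin n × Fin 3) : Set.range (selectionEdge κ lam μ g) ⊆ Edges κ lam μ := by
  rintro _ ⟨⟨j, ν⟩, rfl⟩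
  refine Or.inr ⟨j, ?_⟩
  fin_cases ν <;> simp only [selectionEdge] <;> split_ifs <;>
    simp [occurrenceClause, Sym2.eq_swap]

theorem isMatching_range_selectionEdge {m n : ℕ} (κ lam μ : Fin n → Fin m)
    (g : Fin m → Fin n × Fin 3) : IsMatching (Set.range (selectionEdge κ lam μ g)) := by
  rintro _ ⟨⟨j, ν⟩, rfl⟩ _ ⟨⟨j', ν'⟩, rfl⟩ hne v hv hv'
  refine hne (congrArg _ ?_)
  simp only [selectionEdge, Sym2.mem_iff] at hv hv'
  grind

/-- A satisfying assignment yields a maximal matching of label-1 edges. -/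
theorem exists_maximal_matching_of_satisfiable {m n : ℕ} {κ lam μ : Fin n → Fin m}
    {ψ : Fin n → Bool}
    (hψ : ∀ i : Fin m, ∃ j : Fin n,
      ((κ j = i ∨ lam j = i) ∧ ψ j = true) ∨ (μ j = i ∧ ψ j = false)) :
    ∃ M : Set (Sym2 (Vtx m n) × Bool), M ⊆ Edges κ lam μ ∧ IsMatching M ∧
      (∀ e ∈ Edges κ lam μ, e ∉ M → ¬ IsMatching (insert e M)) ∧ ∀ e ∈ M, e.2 = true := by
  have hsel : ∀ i : Fin m, ∃ p : Fin n × Fin 3,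
      occurrenceClause κ lam μ p = i ∧ ψ p.1 = decide (p.2 ≠ 2) := by
    intro i
    obtain ⟨j, ⟨h | h, ht⟩ | ⟨h, ht⟩⟩ := hψ i
    · exact ⟨(j, 0), h, ht⟩
    · exact ⟨(j, 1), h, ht⟩
    · exact ⟨(j, 2), h, ht⟩
  choose g hocc hval using hsel
  have hM := isMatching_range_selectionEdge κ lam μ g
  refine ⟨_, range_selectionEdge_subset κ lam μ g, hM, fun e he heM => ?_, ?_⟩
  · rw [not_isMatching_insert_iff hM heM]
    have hx : ∀ j ν, Sum.inr (j, ν, true) ∈ e.1 →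
        ∃ e' ∈ Set.range (selectionEdge κ lam μ g), ∃ v, v ∈ e.1 ∧ v ∈ e'.1 :=
      fun j ν hv => ⟨_, ⟨(j, ν), rfl⟩, _, hv, Sym2.mem_mk_left _ _⟩
    have hy : ∀ j ν, ψ j ≠ decide (ν ≠ 2) → Sum.inr (j, ν, false) ∈ e.1 →
        ∃ e' ∈ Set.range (selectionEdge κ lam μ g), ∃ v, v ∈ e.1 ∧ v ∈ e'.1 := by
      intro j ν hne hv
      refine ⟨_, ⟨(j, ν), rfl⟩, _, hv, ?_⟩
      have hg : g (occurrenceClause κ lam μ (j, ν)) ≠ (j, ν) := fun h => hne (by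
        have := hval (occurrenceClause κ lam μ (j, ν))
        rwa [h] at this)
      simp [selectionEdge, hg]
    rcases he with ⟨i, rfl⟩ | ⟨j, rfl | rfl | rfl | rfl | rfl | rfl | rfl | rfl⟩
    · refine ⟨_, ⟨g i, rfl⟩, Sum.inl (i, decide ((g i).2 ≠ 2)), ?_, ?_⟩
      · by_cases h : (g i).2 = 2 <;> simp [h]
      · simp [selectionEdge, hocc]
    · exact hx j 0 (by simp)
    · exact hx j 0 (by simp)
    · exact hx j 1 (by simp)
    · exact hx j 1 (by simp)
    · exact hx j 2 (by simp)
    · exact hx j 2 (by simp)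
    · cases h : ψ j
      · exact hy j 0 (by simp [h]) (by simp)
      · exact hy j 2 (by simp [h]) (by simp)
    · cases h : ψ j
      · exact hy j 1 (by simp [h]) (by simp)
      · exact hy j 2 (by simp [h]) (by simp)
  · rintro _ ⟨p, rfl⟩
    rfl

/-- In a matching, two edges sharing a vertex coincide. -/
theorem IsMatching.eq_of_mem {m n : ℕ} {M : Set (Sym2 (Vtx m n) × Bool)} (hM : IsMatching M)
    {e e' : Sym2 (Vtx m n) × Bool} (he : e ∈ M) (he' : e' ∈ M) {v : Vtx m n}
    (hv : v ∈ e.1) (hv' : v ∈ e'.1) : e = e' :=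
  by_contra fun h => hM e he e' he' h v hv hv'

/-- A maximal matching of label-1 edges yields a satisfying assignment. -/
theorem satisfiable_of_maximal_matching {m n : ℕ} {κ lam μ : Fin n → Fin m}
    {M : Set (Sym2 (Vtx m n) × Bool)} (hsub : M ⊆ Edges κ lam μ) (hM : IsMatching M)
    (hmax : ∀ e ∈ Edges κ lam μ, e ∉ M → ¬ IsMatching (insert e M))
    (hlabel : ∀ e ∈ M, e.2 = true) :
    ∃ ψ : Fin n → Bool, ∀ i : Fin m, ∃ j : Fin n,
      ((κ j = i ∨ lam j = i) ∧ ψ j = true) ∨ (μ j = i ∧ ψ j = false) := by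
  classical
  have hcover : ∀ a b : Vtx m n, (s(a, b), false) ∈ Edges κ lam μ →
      ∃ e ∈ M, a ∈ e.1 ∨ b ∈ e.1 := by
    intro a b hab
    have hnot : (s(a, b), false) ∉ M := fun h => by simpa using hlabel _ h
    obtain ⟨e, he, v, hv, hve⟩ := (not_isMatching_insert_iff hM hnot).1 (hmax _ hab hnot)
    rcases Sym2.mem_iff.1 hv with rfl | rfl
    · exact ⟨e, he, Or.inl hve⟩
    · exact ⟨e, he, Or.inr hve⟩
  let yEdge (j : Fin n) (ν : Fin 3) : Sym2 (Vtx m n) × Bool :=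
    (s(Sum.inr (j, ν, true), Sum.inr (j, ν, false)), true)
  have hyEdge : ∀ e ∈ M, ∀ j ν, Sum.inr (j, ν, false) ∈ e.1 → e = yEdge j ν := by
    intro e he j ν hv
    have hl := hlabel e he
    rcases hsub he with ⟨i, rfl⟩ | ⟨k, rfl | rfl | rfl | rfl | rfl | rfl | rfl | rfl⟩
    · simp at hl
    · simp at hv
    · obtain ⟨rfl, rfl⟩ : j = k ∧ ν = 0 := by simpa using hv
      exact Prod.ext Sym2.eq_swap rfl
    · simp at hv
    · obtain ⟨rfl, rfl⟩ : j = k ∧ ν = 1 := by simpa using hv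
      exact Prod.ext Sym2.eq_swap rfl
    · simp at hv
    · obtain ⟨rfl, rfl⟩ : j = k ∧ ν = 2 := by simpa using hv
      rfl
    · simp at hl
    · simp at hl
  have htrue : ∀ j ν, (s(Sum.inr (j, ν, false), Sum.inr (j, 2, false)), false) ∈ Edges κ lam μ →
      yEdge j ν ∉ M → yEdge j 2 ∈ M := by
    intro j ν hedge hν
    obtain ⟨e, he, hv | hv⟩ := hcover _ _ hedge
    · exact absurd (hyEdge e he j ν hv ▸ he) hν
    · exact hyEdge e he j 2 hv ▸ he
  have hyNot : ∀ i b j ν, (s(Sum.inl (i, b), Sum.inr (j, ν, true)), true) ∈ M →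
      yEdge j ν ∉ M := by
    intro i b j ν he hy
    have := hM.eq_of_mem he hy (v := Sum.inr (j, ν, true)) (by simp) (by simp [yEdge])
    simp [yEdge] at this
  refine ⟨fun j => decide (yEdge j 2 ∈ M), fun i => ?_⟩
  obtain ⟨e, he, hv⟩ := hcover _ _ (Or.inl ⟨i, rfl⟩)
  have hl := hlabel e he
  rcases hsub he with ⟨i, rfl⟩ | ⟨j, rfl | rfl | rfl | rfl | rfl | rfl | rfl | rfl⟩
  · simp at hl
  · refine ⟨j, Or.inl ⟨Or.inl (by simpa [eq_comm] using hv), decide_eq_true ?_⟩⟩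
    exact htrue j 0 (Or.inr ⟨j, by simp⟩) (hyNot _ _ _ _ he)
  · simp at hv
  · refine ⟨j, Or.inl ⟨Or.inr (by simpa [eq_comm] using hv), decide_eq_true ?_⟩⟩
    exact htrue j 1 (Or.inr ⟨j, by simp⟩) (hyNot _ _ _ _ he)
  · simp at hv
  · exact ⟨j, Or.inr ⟨by simpa [eq_comm] using hv,
      decide_eq_false (hyNot _ _ _ _ (Sym2.eq_swap ▸ he))⟩⟩
  · simp at hv
  · simp at hv
  · simp at hv

theorem stmt5 (m n : ℕ) (κ lam μ : Fin n → Fin m)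
    -- every clause contains at most three literals
    (h3 : ∀ i : Fin m,
      (Finset.univ.filter fun j : Fin n => κ j = i).card +
      (Finset.univ.filter fun j : Fin n => lam j = i).card +
      (Finset.univ.filter fun j : Fin n => μ j = i).card ≤ 3) :
    -- φ is satisfiable
    (∃ ψ : Fin n → Bool, ∀ i : Fin m, ∃ j : Fin n,
        ((κ j = i ∨ lam j = i) ∧ ψ j = true) ∨ (μ j = i ∧ ψ j = false)) ↔
      -- G(φ) has a maximal matching all of whose edges have label 1
      (∃ M : Set (Sym2 (Vtx m n) × Bool), M ⊆ Edges κ lam μ ∧ IsMatching M ∧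
        (∀ e ∈ Edges κ lam μ, e ∉ M → ¬ IsMatching (insert e M)) ∧
        ∀ e ∈ M, e.2 = true) := by
  constructor
  · rintro ⟨ψ, hψ⟩
    exact exists_maximal_matching_of_satisfiable hψ
  · rintro ⟨M, hsub, hM, hmax, hlabel⟩
    exact satisfiable_of_maximal_matching hsub hM hmax hlabel
end

section
/- Let Σ be an FD set over {1,…,d}, let D ⊆ dom^d be a finite instance, let S be a nonempty subset of D, define the labeling L(t) = 0 if t ∈ S and L(t) = 1 otherwise, and let < be a strict linear order on D in which every tuple of S precedes every tuple of D \ S. Then the test point is certifiably robust for 1-NN classification with respect to the repairs of D w.r.t. Σ (i.e., the <-minimal tuples of all repairs carry the same label) if and only if no repair I of D w.r.t. Σ satisfies I ∩ S = ∅. -/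
/-- A set `I` of tuples satisfies the FD `fd = (X, B)` if any two tuples of `I`
agreeing on every attribute of `X` also agree on every attribute of `B`. -/
def SatFD {d : ℕ} {dom : Type*} (I : Finset (Fin d → dom))
    (fd : Set (Fin d) × Set (Fin d)) : Prop :=
  ∀ s ∈ I, ∀ t ∈ I, (∀ a ∈ fd.1, s a = t a) → ∀ b ∈ fd.2, s b = t b

/-- `I` satisfies every FD of the FD set `FDs`. -/
def SatFDs {d : ℕ} {dom : Type*} (I : Finset (Fin d → dom))
    (FDs : Set (Set (Fin d) × Set (Fin d))) : Prop :=
  ∀ fd ∈ FDs, SatFD I fd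

/-- `I` is a repair of `D` w.r.t. `FDs`: a subset of `D` satisfying `FDs` that is
maximal under inclusion among the subsets of `D` satisfying `FDs`. -/
def IsFDRepair {d : ℕ} {dom : Type*} (FDs : Set (Set (Fin d) × Set (Fin d)))
    (D I : Finset (Fin d → dom)) : Prop :=
  I ⊆ D ∧ SatFDs I FDs ∧ ∀ J : Finset (Fin d → dom), I ⊆ J → J ⊆ D → SatFDs J FDs → J = I

theorem satFDs_singleton {d : ℕ} {dom : Type*} (FDs : Set (Set (Fin d) × Set (Fin d)))
    (s : Fin d → dom) : SatFDs {s} FDs := by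
  intro fd _ u hu v hv _ b _
  rw [Finset.mem_singleton.1 hu, Finset.mem_singleton.1 hv]

theorem SatFDs.exists_isFDRepair_superset {d : ℕ} {dom : Type*}
    {FDs : Set (Set (Fin d) × Set (Fin d))} {D J : Finset (Fin d → dom)}
    (hJ : SatFDs J FDs) (hJD : J ⊆ D) : ∃ I, IsFDRepair FDs D I ∧ J ⊆ I := by
  have hfin : {I : Finset (Fin d → dom) | I ⊆ D ∧ SatFDs I FDs}.Finite :=
    D.powerset.finite_toSet.subset fun I hI => by simpa using hI.1
  obtain ⟨I, hJI, hI⟩ := hfin.exists_le_maximal (a := J) ⟨hJD, hJ⟩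
  exact ⟨I, ⟨hI.prop.1, hI.prop.2, fun K hIK hKD hK =>
    (hI.le_of_ge ⟨hKD, hK⟩ hIK).antisymm hIK⟩, hJI⟩

theorem IsFDRepair.nonempty {d : ℕ} {dom : Type*} {FDs : Set (Set (Fin d) × Set (Fin d))}
    {D I : Finset (Fin d → dom)} (hI : IsFDRepair FDs D I) (hD : D.Nonempty) :
    I.Nonempty := by
  obtain ⟨s, hs⟩ := hD
  by_contra hne
  rw [Finset.not_nonempty_iff_eq_empty] at hne
  subst hne
  exact Finset.singleton_ne_empty s (hI.2.2 {s} (Finset.empty_subset _)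
    (Finset.singleton_subset_iff.2 hs) (satFDs_singleton FDs s))

theorem stmt8 {d : ℕ} {dom : Type*} [DecidableEq dom] [LinearOrder (Fin d → dom)]
    (FDs : Set (Set (Fin d) × Set (Fin d)))
    (D S : Finset (Fin d → dom)) (hSD : S ⊆ D) (hS : S.Nonempty)
    (L : (Fin d → dom) → Fin 2) (hL : ∀ t, L t = if t ∈ S then 0 else 1)
    -- every tuple of S precedes every tuple of D \ S
    (hord : ∀ s ∈ S, ∀ t ∈ D, t ∉ S → s < t) :
    -- the test point is certifiably robust for 1-NN classification w.r.t. the repairs: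
    -- the <-minimal tuples of all repairs carry the same label
    (∃ ℓ : Fin 2, ∀ I : Finset (Fin d → dom), IsFDRepair FDs D I →
        ∀ t ∈ I, (∀ u ∈ I, t ≤ u) → L t = ℓ) ↔
      ¬ ∃ I : Finset (Fin d → dom), IsFDRepair FDs D I ∧ I ∩ S = ∅ := by
  have mem_of_min : ∀ I : Finset (Fin d → dom), I ⊆ D → ∀ t ∈ I, (∀ u ∈ I, t ≤ u) →
      ∀ s ∈ I, s ∈ S → t ∈ S := by
    intro I hID t ht hmin s hsI hsS
    by_contra htS
    exact (hord s hsS t (hID ht) htS).not_ge (hmin s hsI)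
  constructor
  · rintro ⟨ℓ, hℓ⟩ ⟨I, hI, hIS⟩
    obtain ⟨s, hs⟩ := hS
    obtain ⟨J, hJ, hsJ⟩ := (satFDs_singleton FDs s).exists_isFDRepair_superset
      (Finset.singleton_subset_iff.2 (hSD hs))
    rw [Finset.singleton_subset_iff] at hsJ
    obtain ⟨t, ht, htmin⟩ := I.exists_min_image id (hI.nonempty ⟨s, hSD hs⟩)
    obtain ⟨v, hv, hvmin⟩ := J.exists_min_image id ⟨s, hsJ⟩
    have htS : t ∉ S := fun h => by
      have hmem := Finset.mem_inter.2 ⟨ht, h⟩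
      rw [hIS] at hmem
      exact Finset.notMem_empty t hmem
    have hvS : v ∈ S := mem_of_min J hJ.1 v hv hvmin s hsJ hs
    have h := (hℓ I hI t ht htmin).trans (hℓ J hJ v hv hvmin).symm
    rw [hL, hL, if_neg htS, if_pos hvS] at h
    exact one_ne_zero h
  · intro h
    refine ⟨0, fun I hI t ht hmin => ?_⟩
    obtain ⟨s, hs⟩ := Finset.nonempty_iff_ne_empty.2 fun hIS => h ⟨I, hI, hIS⟩
    rw [Finset.mem_inter] at hs
    rw [hL, if_pos (mem_of_min I hI.1 t ht hmin s hs.1 hs.2)]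
end

section
/- Let Σ be an FD set over {1,…,d}, let D ⊆ dom^d be a finite instance, let t ∈ D, and let D_t = {s ∈ D : the two-element set {s, t} satisfies Σ} (note t ∈ D_t). Then every repair of D_t w.r.t. Σ contains t, and a subset I ⊆ D is a repair of D w.r.t. Σ with t ∈ I if and only if I is a repair of D_t w.r.t. Σ. -/
theorem SatFDs.mono {d : ℕ} {dom : Type*} {FDs : Set (Set (Fin d) × Set (Fin d))}
    {I J : Finset (Fin d → dom)} (hJ : SatFDs J FDs) (hIJ : I ⊆ J) : SatFDs I FDs :=
  fun fd hfd s hs u hu => hJ fd hfd s (hIJ hs) u (hIJ hu)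

/-- Inserting a tuple that is pairwise consistent with a consistent set keeps it consistent. -/
theorem SatFDs.insert {d : ℕ} {dom : Type*} [DecidableEq dom]
    {FDs : Set (Set (Fin d) × Set (Fin d))} {I : Finset (Fin d → dom)} {t : Fin d → dom}
    (hI : SatFDs I FDs) (h : ∀ s ∈ I, SatFDs ({s, t} : Finset (Fin d → dom)) FDs) :
    SatFDs (insert t I) FDs := by
  intro fd hfd s hs u hu
  rcases Finset.mem_insert.1 hs with rfl | hsI <;> rcases Finset.mem_insert.1 hu with rfl | huI
  · exact fun _ _ _ => rfl
  · exact h u huI fd hfd s (by simp) u (by simp)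
  · exact h s hsI fd hfd s (by simp) u (by simp)
  · exact hI fd hfd s hsI u huI

theorem stmt9 {d : ℕ} {dom : Type*} [DecidableEq dom]
    (FDs : Set (Set (Fin d) × Set (Fin d)))
    (D : Finset (Fin d → dom)) (t : Fin d → dom) (ht : t ∈ D)
    -- Dt = { s ∈ D : the two-element set {s, t} satisfies FDs }
    (Dt : Finset (Fin d → dom))
    (hDt : ∀ s, s ∈ Dt ↔ s ∈ D ∧ SatFDs ({s, t} : Finset (Fin d → dom)) FDs) :
    (∀ I : Finset (Fin d → dom), IsFDRepair FDs Dt I → t ∈ I) ∧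
      (∀ I : Finset (Fin d → dom), (IsFDRepair FDs D I ∧ t ∈ I) ↔ IsFDRepair FDs Dt I) := by
  have htDt : t ∈ Dt := (hDt t).2 ⟨ht, fun fd _ s hs u hu _ _ _ => by simp_all⟩
  have hsub : Dt ⊆ D := fun s hs => ((hDt s).1 hs).1
  have subset_Dt {J : Finset (Fin d → dom)} (hJD : J ⊆ D) (hJ : SatFDs J FDs) (htJ : t ∈ J) :
      J ⊆ Dt := fun s hs =>
    (hDt s).2 ⟨hJD hs, hJ.mono (by simp [Finset.insert_subset_iff, hs, htJ])⟩
  have mem_repair : ∀ I : Finset (Fin d → dom), IsFDRepair FDs Dt I → t ∈ I := by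
    rintro I ⟨hID, hI, hmax⟩
    rw [← hmax (insert t I) (Finset.subset_insert t I) (Finset.insert_subset htDt hID)
      (hI.insert fun s hs => ((hDt s).1 (hID hs)).2)]
    exact Finset.mem_insert_self t I
  refine ⟨mem_repair, fun I => ⟨?_, fun hrep => ⟨?_, mem_repair I hrep⟩⟩⟩
  · rintro ⟨⟨hID, hI, hmax⟩, htI⟩
    exact ⟨subset_Dt hID hI htI, hI, fun J hIJ hJ => hmax J hIJ (hJ.trans hsub)⟩
  · have htI := mem_repair I hrep
    obtain ⟨hID, hI, hmax⟩ := hrep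
    exact ⟨hID.trans hsub, hI, fun J hIJ hJD hJ =>
      hmax J hIJ (subset_Dt hJD hJ (hIJ htI)) hJ⟩
end

section
/- Let Σ be an FD set over {1,…,d} such that some attribute A belongs to the left-hand side of every FD of Σ, and let D ⊆ dom^d be a finite instance. Then a subset I ⊆ D is a repair of D w.r.t. Σ if and only if for every value a ∈ π_A(D), the set I ∩ σ_{A=a}(D) is a repair of σ_{A=a}(D) w.r.t. Σ − A. -/
/-- `FDs − A`: remove attribute `A` from the left- and right-hand side of every FD. -/
def removeAttr {d : ℕ} (A : Fin d) (FDs : Set (Set (Fin d) × Set (Fin d))) :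
    Set (Set (Fin d) × Set (Fin d)) :=
  (fun fd => (fd.1 \ {A}, fd.2 \ {A})) '' FDs

/-- When `A` lies in every left-hand side, satisfaction of `FDs` can be checked on each block of
tuples sharing their `A`-value, against `FDs − A`. -/
theorem satFDs_iff_forall_filter {d : ℕ} {dom : Type*} [DecidableEq dom]
    {FDs : Set (Set (Fin d) × Set (Fin d))} {A : Fin d} (hA : ∀ fd ∈ FDs, A ∈ fd.1)
    (J : Finset (Fin d → dom)) :
    SatFDs J FDs ↔ ∀ a, SatFDs (J.filter (fun t => t A = a)) (removeAttr A FDs) := by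
  constructor
  · rintro h a _ ⟨fd, hfd, rfl⟩ s hs t ht hst b hb
    rw [Finset.mem_filter] at hs ht
    refine h fd hfd s hs.1 t ht.1 (fun c hc => ?_) b hb.1
    by_cases hcA : c = A
    · rw [hcA, hs.2, ht.2]
    · exact hst c ⟨hc, hcA⟩
  · intro h fd hfd s hs t ht hst b hb
    have hstA : s A = t A := hst A (hA fd hfd)
    by_cases hbA : b = A
    · rwa [hbA]
    · exact h (t A) _ ⟨fd, hfd, rfl⟩ s (Finset.mem_filter.2 ⟨hs, hstA⟩) t
        (Finset.mem_filter.2 ⟨ht, rfl⟩) (fun c hc => hst c hc.1) b ⟨hb, hbA⟩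

theorem stmt11 {d : ℕ} {dom : Type*} [DecidableEq dom]
    (FDs : Set (Set (Fin d) × Set (Fin d))) (A : Fin d)
    -- A belongs to the left-hand side of every FD of FDs
    (hA : ∀ fd ∈ FDs, A ∈ fd.1)
    (D : Finset (Fin d → dom))
    (I : Finset (Fin d → dom)) (hI : I ⊆ D) :
    IsFDRepair FDs D I ↔
      ∀ a ∈ D.image (fun t => t A),
        IsFDRepair (removeAttr A FDs) (D.filter (fun t => t A = a))
          (I ∩ D.filter (fun t => t A = a)) := by
  have inter_filter (a : dom) :
      I ∩ D.filter (fun t => t A = a) = I.filter (fun t => t A = a) := by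
    rw [Finset.inter_filter, Finset.inter_eq_left.2 hI]
  simp only [inter_filter]
  constructor
  · rintro ⟨-, hsat, hmax⟩ a -
    rw [satFDs_iff_forall_filter hA] at hsat
    refine ⟨Finset.filter_subset_filter _ hI, hsat a, fun J hIJ hJD hJ => ?_⟩
    have hJA : ∀ t ∈ J, t A = a := fun t ht => (Finset.mem_filter.1 (hJD ht)).2
    have hunion : I ∪ J = I := by
      refine hmax _ Finset.subset_union_left
        (Finset.union_subset hI (hJD.trans (Finset.filter_subset _ _))) ?_
      rw [satFDs_iff_forall_filter hA]
      intro b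
      rw [Finset.filter_union]
      by_cases hba : b = a
      · subst hba
        rwa [Finset.filter_true_of_mem hJA, Finset.union_eq_right.2 hIJ]
      · rw [Finset.filter_false_of_mem (s := J) (p := fun t => t A = b)
            fun t ht htb => hba (htb.symm.trans (hJA t ht)),
          Finset.union_empty]
        exact hsat b
    refine Finset.Subset.antisymm (fun t ht => ?_) hIJ
    exact Finset.mem_filter.2 ⟨Finset.union_eq_left.1 hunion ht, hJA t ht⟩
  · intro h
    refine ⟨hI, ?_, fun J hIJ hJD hJ => Finset.Subset.antisymm (fun t ht => ?_) hIJ⟩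
    · rw [satFDs_iff_forall_filter hA]
      intro a
      by_cases ha : a ∈ D.image (fun t => t A)
      · exact (h a ha).2.1
      · rw [Finset.filter_false_of_mem fun t ht hta =>
          ha (Finset.mem_image.2 ⟨t, hI ht, hta⟩)]
        exact fun _ _ s hs => absurd hs (Finset.notMem_empty s)
    · have hblock := (h (t A) (Finset.mem_image_of_mem _ (hJD ht))).2.2 _
        (Finset.filter_subset_filter _ hIJ) (Finset.filter_subset_filter _ hJD)
        ((satFDs_iff_forall_filter hA J).1 hJ (t A))
      have htJ : t ∈ J.filter (fun u => u A = t A) := Finset.mem_filter.2 ⟨ht, rfl⟩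
      rw [hblock] at htJ
      exact (Finset.mem_filter.1 htJ).1
end

section
/- Let Σ be an FD set over {1,…,d} such that some attribute A belongs to the left-hand side of every FD of Σ, and let D ⊆ dom^d be a finite instance. Then the number of repairs of D w.r.t. Σ equals the product over all a ∈ π_A(D) of the number of repairs of σ_{A=a}(D) w.r.t. Σ − A. -/
theorem satFDs_iff_filter {d : ℕ} {dom : Type*} [DecidableEq dom]
    {FDs : Set (Set (Fin d) × Set (Fin d))} {A : Fin d} (hA : ∀ fd ∈ FDs, A ∈ fd.1)
    (I : Finset (Fin d → dom)) :
    SatFDs I FDs ↔ ∀ a, SatFDs (I.filter (fun t => t A = a)) (removeAttr A FDs) := by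
  constructor
  · rintro h a _ ⟨fd, hfd, rfl⟩ s hs t ht hst b hb
    rw [Finset.mem_filter] at hs ht
    refine h fd hfd s hs.1 t ht.1 (fun c hc => ?_) b hb.1
    by_cases hcA : c = A
    · rw [hcA, hs.2, ht.2]
    · exact hst c ⟨hc, hcA⟩
  · intro h fd hfd s hs t ht hst b hb
    by_cases hbA : b = A
    · exact hbA ▸ hst A (hA fd hfd)
    · exact h (s A) _ ⟨fd, hfd, rfl⟩ s (by simp [hs]) t
        (by simp [ht, hst A (hA fd hfd)]) (fun c hc => hst c hc.1) b ⟨hb, hbA⟩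

theorem isFDRepair_iff_filter {d : ℕ} {dom : Type*} [DecidableEq dom]
    {FDs : Set (Set (Fin d) × Set (Fin d))} {A : Fin d} (hA : ∀ fd ∈ FDs, A ∈ fd.1)
    (D I : Finset (Fin d → dom)) :
    IsFDRepair FDs D I ↔ I ⊆ D ∧ ∀ a ∈ D.image (fun t => t A),
      IsFDRepair (removeAttr A FDs) (D.filter (fun t => t A = a))
        (I.filter (fun t => t A = a)) := by
  constructor
  · rintro ⟨hID, hsat, hmax⟩
    refine ⟨hID, fun a _ => ⟨Finset.filter_subset_filter _ hID,
      (satFDs_iff_filter hA I).1 hsat a, fun J hIJ hJD hJ => ?_⟩⟩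
    have hJA : ∀ t ∈ J, t A = a := fun t ht => (Finset.mem_filter.1 (hJD ht)).2
    have hunion : I ∪ J = I := by
      refine hmax _ Finset.subset_union_left (Finset.union_subset hID
        (hJD.trans (Finset.filter_subset _ _))) ((satFDs_iff_filter hA _).2 fun b => ?_)
      by_cases hb : b = a
      · have : (I ∪ J).filter (fun t => t A = b) = J := by
          subst hb
          rw [Finset.filter_union, Finset.filter_true_of_mem hJA]
          exact Finset.union_eq_right.2 hIJ
        rwa [this]
      · have : (I ∪ J).filter (fun t => t A = b) = I.filter (fun t => t A = b) := by
          rw [Finset.filter_union, Finset.filter_false_of_mem (s := J)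
            (fun t ht h => hb (h.symm.trans (hJA t ht))), Finset.union_empty]
        rw [this]
        exact (satFDs_iff_filter hA I).1 hsat b
    refine Finset.Subset.antisymm (fun t ht => ?_) hIJ
    exact Finset.mem_filter.2 ⟨Finset.union_eq_left.1 hunion ht, hJA t ht⟩
  · rintro ⟨hID, h⟩
    refine ⟨hID, (satFDs_iff_filter hA I).2 fun a => ?_, fun J hIJ hJD hJ => ?_⟩
    · by_cases ha : a ∈ D.image (fun t => t A)
      · exact (h a ha).2.1
      · intro fd _ s hs
        rw [Finset.mem_filter] at hs
        exact absurd (Finset.mem_image.2 ⟨s, hID hs.1, hs.2⟩) ha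
    · refine Finset.Subset.antisymm (fun t ht => ?_) hIJ
      have heq := (h (t A) (Finset.mem_image_of_mem _ (hJD ht))).2.2
        (J.filter (fun s => s A = t A)) (Finset.filter_subset_filter _ hIJ)
        (Finset.filter_subset_filter _ hJD) ((satFDs_iff_filter hA J).1 hJ (t A))
      have hmem : t ∈ J.filter (fun s => s A = t A) := Finset.mem_filter.2 ⟨ht, rfl⟩
      rw [heq] at hmem
      exact (Finset.mem_filter.1 hmem).1

theorem filter_biUnion_eq {d : ℕ} {dom : Type*} [DecidableEq dom] {A : Fin d} {S : Finset dom}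
    (f : S → Finset (Fin d → dom)) (hf : ∀ a, ∀ t ∈ f a, t A = a) (a : S) :
    (Finset.univ.biUnion f).filter (fun t => t A = (a : dom)) = f a := by
  ext t
  simp only [Finset.mem_filter, Finset.mem_biUnion, Finset.mem_univ, true_and]
  constructor
  · rintro ⟨⟨b, hb⟩, ht⟩
    have hba : b = a := Subtype.ext ((hf b t hb).symm.trans ht)
    rwa [← hba]
  · exact fun ht => ⟨⟨a, ht⟩, hf a t ht⟩

theorem stmt12 {d : ℕ} {dom : Type*} [DecidableEq dom]
    (FDs : Set (Set (Fin d) × Set (Fin d))) (A : Fin d)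
    -- A belongs to the left-hand side of every FD of FDs
    (hA : ∀ fd ∈ FDs, A ∈ fd.1)
    (D : Finset (Fin d → dom)) :
    {I : Finset (Fin d → dom) | IsFDRepair FDs D I}.ncard =
      ∏ a ∈ D.image (fun t => t A),
        {I : Finset (Fin d → dom) |
          IsFDRepair (removeAttr A FDs) (D.filter (fun t => t A = a)) I}.ncard := by
  rw [← Finset.prod_coe_sort]
  simp only [← Nat.card_coe_set_eq]
  rw [← Nat.card_pi]
  refine Nat.card_eq_of_bijective (fun I a => ⟨I.1.filter (fun t => t A = a),
    ((isFDRepair_iff_filter hA D I.1).1 I.2).2 a a.2⟩) ⟨fun I J hIJ => ?_, fun f => ?_⟩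
  · ext t
    by_cases ha : t A ∈ D.image (fun t => t A)
    · have := congrArg (fun g => t ∈ (g ⟨t A, ha⟩).1) hIJ
      simpa using this
    · have hD : t ∉ D := fun ht => ha (Finset.mem_image_of_mem _ ht)
      exact iff_of_false (fun h => hD (I.2.1 h)) (fun h => hD (J.2.1 h))
  · have hf := filter_biUnion_eq (A := A) (fun a => (f a).1)
      (fun a t ht => (Finset.mem_filter.1 ((f a).2.1 ht)).2)
    refine ⟨⟨Finset.univ.biUnion fun a => (f a).1,
      (isFDRepair_iff_filter hA D _).2 ⟨?_, fun a ha => ?_⟩⟩, ?_⟩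
    · exact Finset.biUnion_subset.2 fun a _ => (f a).2.1.trans (Finset.filter_subset _ _)
    · rw [hf ⟨a, ha⟩]
      exact (f ⟨a, ha⟩).2
    · exact funext fun a => Subtype.ext (hf a)
end
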